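/- Let $m \le M$ be real numbers, let $\iota$ be a nonempty directed preordered index set, let $(\mu_i)_{i\in\iota}$ be a monotone family of Borel measures on the real line, each with total mass at most $1$ and supported in $[m,M]$, and let $\mu$ be a Borel measure with $\mu(A) = \sup_{i\in\iota}\mu_i(A)$ for every Borel set $A$ (so $\mu$ also has mass at most $1$ and is supported in $[m,M]$). Then $\bigcap_{i\in\iota}\left[\int t\,d\mu_i + m(1-\mu_i(\mathbb{R})),\; \int t\,d\mu_i + M(1-\mu_i(\mathbb{R}))\right] = \left[\int t\,d\mu + m(1-\mu(\mathbb{R})),\; \int t\,d\mu + M(1-\mu(\mathbb{R}))\right]$. -/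

import Mathlib

open MeasureTheory

lemma integrable_id_of_measure_compl_Icc_eq_zero {m M : ℝ} {ν : Measure ℝ} [IsFiniteMeasure ν]
    (hν : ν (Set.Icc m M)ᶜ = 0) : Integrable (fun t : ℝ => t) ν :=
  Integrable.of_mem_Icc m M aemeasurable_id (mem_ae_iff.mpr hν)

lemma integral_id_mem_Icc_of_measure_compl_Icc_eq_zero {m M : ℝ} {ν : Measure ℝ}
    [IsFiniteMeasure ν] (hν : ν (Set.Icc m M)ᶜ = 0) :
    ∫ t, t ∂ν ∈ Set.Icc (m * ν.real Set.univ) (M * ν.real Set.univ) := by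
  have hae : ∀ᵐ t ∂ν, t ∈ Set.Icc m M := mem_ae_iff.mpr hν
  have hint := integrable_id_of_measure_compl_Icc_eq_zero hν
  constructor
  · have h := integral_mono_ae (integrable_const m) hint (hae.mono fun t ht => ht.1)
    rw [integral_const, smul_eq_mul] at h
    linarith
  · have h := integral_mono_ae hint (integrable_const M) (hae.mono fun t ht => ht.2)
    rw [integral_const, smul_eq_mul] at h
    linarith

/-- The increment of the mean between comparable measures supported in `[m, M]` is controlled
by the increment of the mass. -/
lemma integral_id_sub_mem_Icc_of_le {m M : ℝ} {θ μ : Measure ℝ} [IsFiniteMeasure μ]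
    (hle : θ ≤ μ) (hμ : μ (Set.Icc m M)ᶜ = 0) :
    ∫ t, t ∂μ - ∫ t, t ∂θ ∈ Set.Icc (m * (μ.real Set.univ - θ.real Set.univ))
      (M * (μ.real Set.univ - θ.real Set.univ)) := by
  have : IsFiniteMeasure θ := isFiniteMeasure_of_le μ hle
  have hsub : μ - θ + θ = μ := Measure.sub_add_cancel_of_le hle
  have hν : (μ - θ) (Set.Icc m M)ᶜ = 0 := le_antisymm ((Measure.sub_le _).trans hμ.le) bot_le
  have hθ : θ (Set.Icc m M)ᶜ = 0 := le_antisymm ((hle _).trans hμ.le) bot_le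
  have hint : ∫ t, t ∂μ = ∫ t, t ∂(μ - θ) + ∫ t, t ∂θ := by
    conv_lhs => rw [← hsub]
    exact integral_add_measure (integrable_id_of_measure_compl_Icc_eq_zero hν)
      (integrable_id_of_measure_compl_Icc_eq_zero hθ)
  have hmass : μ.real Set.univ = (μ - θ).real Set.univ + θ.real Set.univ := by
    conv_lhs => rw [← hsub]
    exact measureReal_add_apply
  rw [hint, hmass, add_sub_cancel_right, add_sub_cancel_right]
  exact integral_id_mem_Icc_of_measure_compl_Icc_eq_zero hν

/-- for a monotone family `(μᵢ)` of subprobability Borel measures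
on `ℝ` supported in `[m,M]`, indexed by a nonempty directed preorder, with
pointwise supremum `μ`, the intersection of the expected-value intervals of the
`μᵢ` equals the expected-value interval of `μ`, where the expected-value
interval of `θ` is `[∫ t dθ + m(1-θ(ℝ)), ∫ t dθ + M(1-θ(ℝ))]`. -/
theorem stmt_12 (m M : ℝ) (hmM : m ≤ M)
    {ι : Type*} [Preorder ι] [Nonempty ι] [IsDirected ι (· ≤ ·)]
    (μs : ι → Measure ℝ)
    (hmass : ∀ i, μs i Set.univ ≤ 1) (hsupp : ∀ i, μs i (Set.Icc m M)ᶜ = 0)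
    (hmono : ∀ i j : ι, i ≤ j → ∀ A : Set ℝ, MeasurableSet A → μs i A ≤ μs j A)
    (μ : Measure ℝ) (hsup : ∀ A : Set ℝ, MeasurableSet A → μ A = ⨆ i, μs i A) :
    (⋂ i : ι, Set.Icc ((∫ t, t ∂(μs i)) + m * (1 - (μs i Set.univ).toReal))
        ((∫ t, t ∂(μs i)) + M * (1 - (μs i Set.univ).toReal))) =
      Set.Icc ((∫ t, t ∂μ) + m * (1 - (μ Set.univ).toReal))
        ((∫ t, t ∂μ) + M * (1 - (μ Set.univ).toReal)) := by
  have hle : ∀ i, μs i ≤ μ := fun i =>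
    Measure.le_iff.mpr fun A hA => (hsup A hA).symm ▸ le_iSup (fun j => μs j A) i
  have hμuniv : μ Set.univ ≤ 1 := by
    rw [hsup _ MeasurableSet.univ]
    exact iSup_le hmass
  have : IsFiniteMeasure μ := ⟨hμuniv.trans_lt ENNReal.one_lt_top⟩
  have hμ : μ (Set.Icc m M)ᶜ = 0 := by
    simp [hsup _ measurableSet_Icc.compl, hsupp]
  have hmean := fun i => integral_id_sub_mem_Icc_of_le (hle i) hμ
  have happrox : ∀ ε > 0, ∃ i,
      (M - m) * ((μ Set.univ).toReal - (μs i Set.univ).toReal) ≤ ε := by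
    intro ε hε
    have hsupReal : (μ Set.univ).toReal = ⨆ i, (μs i Set.univ).toReal := by
      rw [hsup _ MeasurableSet.univ, ENNReal.toReal_iSup fun i =>
        ((hmass i).trans_lt ENNReal.one_lt_top).ne]
    have hpos : 0 < M - m + 1 := by linarith
    have hδ : 0 < ε / (M - m + 1) := by positivity
    obtain ⟨i, hi⟩ := exists_lt_of_lt_ciSup
      ((sub_lt_self (μ Set.univ).toReal hδ).trans_eq hsupReal)
    refine ⟨i, ?_⟩
    have hmul : ε / (M - m + 1) * (M - m + 1) = ε := div_mul_cancel₀ _ hpos.ne'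
    nlinarith [mul_le_mul_of_nonneg_left hi.le (sub_nonneg.mpr hmM)]
  ext x
  simp only [Set.mem_iInter, Set.mem_Icc, Measure.real] at hmean ⊢
  constructor
  · intro hx
    constructor <;> refine le_of_forall_pos_le_add fun ε hε => ?_ <;>
      obtain ⟨i, hi⟩ := happrox ε hε
    · linarith [(hx i).1, (hmean i).2]
    · linarith [(hx i).2, (hmean i).1]
  · intro hx i
    constructor
    · linarith [hx.1, (hmean i).1]
    · linarith [hx.2, (hmean i).2]
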